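/- Let Π be a projective plane of order q and let S be a set of i points of Π with i ≥ 2, such that there exists at least one line of Π disjoint from S. Then there exists a point P of Π not in S such that |R(S ∪ {P})| ≤ |R(S)| · (1 − i(q−1)/(q(q+1))), where R(T) denotes the set of points of Π not in T that do not lie on any line containing at least two points of T. -/

import Mathlib

/-- A (not necessarily Desarguesian) projective plane of order `q`:
a finite incidence structure of points and lines such that any two distinct
points lie on a unique common line, any two distinct lines meet in a unique
point, there exist four points no three collinear, and every line contains
exactly `q + 1` points. -/
structure ProjPlane (q : ℕ) where
  Point : Type
  Line : Type
  finite_point : Finite Point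
  finite_line : Finite Line
  incid : Point → Line → Prop
  line_unique : ∀ P Q : Point, P ≠ Q → ∃! l : Line, incid P l ∧ incid Q l
  point_unique : ∀ l m : Line, l ≠ m → ∃! P : Point, incid P l ∧ incid P m
  nondeg : ∃ P₁ P₂ P₃ P₄ : Point,
    P₁ ≠ P₂ ∧ P₁ ≠ P₃ ∧ P₁ ≠ P₄ ∧ P₂ ≠ P₃ ∧ P₂ ≠ P₄ ∧ P₃ ≠ P₄ ∧
    (∀ l : Line, ¬(incid P₁ l ∧ incid P₂ l ∧ incid P₃ l)) ∧
    (∀ l : Line, ¬(incid P₁ l ∧ incid P₂ l ∧ incid P₄ l)) ∧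
    (∀ l : Line, ¬(incid P₁ l ∧ incid P₃ l ∧ incid P₄ l)) ∧
    (∀ l : Line, ¬(incid P₂ l ∧ incid P₃ l ∧ incid P₄ l))
  line_card : ∀ l : Line, Nat.card {P : Point // incid P l} = q + 1

/-- A point set `S` is saturating if every point of the plane not in `S`
lies on a line containing at least two points of `S`. -/
def ProjPlane.Saturating {q : ℕ} (PP : ProjPlane q) (S : Set PP.Point) : Prop :=
  ∀ Q : PP.Point, Q ∉ S → ∃ A ∈ S, ∃ B ∈ S, A ≠ B ∧
    ∃ l : PP.Line, PP.incid A l ∧ PP.incid B l ∧ PP.incid Q l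

/-- `R(T)`: the set of points of the plane not in `T` that do not lie on any
line containing at least two points of `T` (the points not covered by `T`). -/
def ProjPlane.uncov {q : ℕ} (PP : ProjPlane q) (T : Set PP.Point) : Set PP.Point :=
  {Q : PP.Point | Q ∉ T ∧ ¬ ∃ A ∈ T, ∃ B ∈ T, A ≠ B ∧
    ∃ l : PP.Line, PP.incid A l ∧ PP.incid B l ∧ PP.incid Q l}

namespace ProjPlane

variable {q : ℕ} (PP : ProjPlane q)

/-- The set of points on a line. -/
def pts (l : PP.Line) : Set PP.Point := {P | PP.incid P l}

theorem ncard_pts (l : PP.Line) : (PP.pts l).ncard = q + 1 :=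
  (Nat.card_coe_set_eq (PP.pts l)).symm.trans (PP.line_card l)

variable {PP}

theorem ncard_pts_sdiff_singleton {P : PP.Point} {l : PP.Line} (h : PP.incid P l) :
    (PP.pts l \ {P}).ncard = q := by
  rw [Set.ncard_sdiff_singleton_of_mem (s := PP.pts l) h, ncard_pts, Nat.add_sub_cancel]

theorem line_eq {P Q : PP.Point} {l m : PP.Line} (h : P ≠ Q) (hPl : PP.incid P l)
    (hQl : PP.incid Q l) (hPm : PP.incid P m) (hQm : PP.incid Q m) : l = m :=
  (PP.line_unique P Q h).unique ⟨hPl, hQl⟩ ⟨hPm, hQm⟩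

theorem exists_line {P Q : PP.Point} (h : P ≠ Q) :
    ∃ l, PP.incid P l ∧ PP.incid Q l :=
  (PP.line_unique P Q h).exists

theorem uncov_anti {S T : Set PP.Point} (h : S ⊆ T) : PP.uncov T ⊆ PP.uncov S := by
  rintro Q ⟨hQ, hcov⟩
  refine ⟨fun hS => hQ (h hS), ?_⟩
  rintro ⟨A, hA, B, hB, hAB⟩
  exact hcov ⟨A, h hA, B, h hB, hAB⟩

/-- A point together with a line not through it bounds the number of points of the plane. -/
theorem ncard_compl_singleton_le {A : PP.Point} {l : PP.Line} (hA : ¬ PP.incid A l) :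
    ({A}ᶜ : Set PP.Point).ncard ≤ q * (q + 1) := by
  classical
  have := PP.finite_point
  have := Fintype.ofFinite PP.Point
  have hline : ∀ X : PP.Point, ∃ m : PP.Line, PP.incid A m ∧ (X ≠ A → PP.incid X m) := by
    intro X
    by_cases hX : X = A
    · obtain ⟨Y, hY⟩ : ∃ Y, Y ∈ PP.pts l :=
        Set.nonempty_of_ncard_ne_zero (by rw [ncard_pts]; omega)
      obtain ⟨m, hm, -⟩ := exists_line (fun h : A = Y => hA (h ▸ hY))
      exact ⟨m, hm, fun h => (h hX).elim⟩
    · obtain ⟨m, hm⟩ := exists_line hX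
      exact ⟨m, hm.2, fun _ => hm.1⟩
  choose f hfA hf using hline
  have hsub : ({A}ᶜ : Set PP.Point).toFinset ⊆
      (PP.pts l).toFinset.biUnion fun X => (PP.pts (f X) \ {A}).toFinset := by
    intro Y hY
    have hYA : Y ≠ A := by simpa using hY
    have hne : f Y ≠ l := fun h => hA (h ▸ hfA Y)
    obtain ⟨X, hX, hXl⟩ := (PP.point_unique _ _ hne).exists
    have hXA : X ≠ A := fun h => hA (h ▸ hXl)
    have hfX : f X = f Y := line_eq hXA (hf X hXA) (hfA X) hX (hfA Y)
    simp only [Finset.mem_biUnion, Set.mem_toFinset]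
    exact ⟨X, hXl, (show PP.incid Y (f X) from hfX ▸ hf Y hYA), hYA⟩
  rw [Set.ncard_eq_toFinset_card']
  refine (Finset.card_le_card hsub).trans
    ((Finset.card_biUnion_le_card_mul _ _ q fun X _ => ?_).trans_eq ?_)
  · rw [← Set.ncard_eq_toFinset_card', ncard_pts_sdiff_singleton (hfA X)]
  · rw [← Set.ncard_eq_toFinset_card', ncard_pts, mul_comm]

/-- An uncovered point `Q` becomes covered by adding any point, other than `Q` itself and the points
of `S`, of a line joining `Q` to a point of `S`; there are `|S| (q - 1)` such points. -/
theorem mul_le_ncard_covering {S : Set PP.Point} {Q : PP.Point} (hQ : Q ∈ PP.uncov S) :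
    S.ncard * (q - 1) ≤ {P | P ∉ S ∧ Q ∉ PP.uncov (S ∪ {P})}.ncard := by
  classical
  have := PP.finite_point
  have := Fintype.ofFinite PP.Point
  obtain ⟨hQS, hcov⟩ := hQ
  have hline : ∀ A : S, ∃ m : PP.Line, PP.incid Q m ∧ PP.incid (A : PP.Point) m :=
    fun A => exists_line fun h => hQS (h ▸ A.2)
  choose f hfQ hfA using hline
  have htangent : ∀ A : S, ∀ B ∈ S, PP.incid B (f A) → B = A := fun A B hB hBf => by
    by_contra hne
    exact hcov ⟨B, hB, A, A.2, hne, f A, hBf, hfA A, hfQ A⟩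
  have hcard : (Finset.univ.biUnion fun A : S => ((PP.pts (f A) \ {Q}) \ {A.1}).toFinset).card =
      S.ncard * (q - 1) := by
    rw [Finset.card_biUnion]
    · rw [Finset.sum_const_nat (m := q - 1), Finset.card_univ, Set.ncard_eq_toFinset_card',
        Set.toFinset_card]
      intro A _
      rw [← Set.ncard_eq_toFinset_card', Set.ncard_sdiff_singleton_of_mem,
        ncard_pts_sdiff_singleton (hfQ A)]
      exact ⟨hfA A, fun h => hQS (h ▸ A.2)⟩
    · intro A _ B _ hAB
      rw [Function.onFun, Finset.disjoint_left]
      intro X hXA hXB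
      rw [Set.mem_toFinset] at hXA hXB
      have hfAB : f A = f B := line_eq hXA.1.2 hXA.1.1 (hfQ A) hXB.1.1 (hfQ B)
      exact hAB (Subtype.ext (htangent B A A.2 (hfAB ▸ hfA A)))
  rw [← hcard, Set.ncard_eq_toFinset_card']
  refine Finset.card_le_card fun P hP => ?_
  simp only [Finset.mem_biUnion, Set.mem_toFinset] at hP ⊢
  obtain ⟨A, -, ⟨hPf, -⟩, hPA⟩ := hP
  exact ⟨fun hPS => hPA (htangent A P hPS hPf), fun h => h.2
    ⟨A, Or.inl A.2, P, Or.inr rfl, fun h => hPA h.symm, f A, hfA A, hPf, hfQ A⟩⟩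

end ProjPlane

theorem greedy_step_bound (q i : ℕ) (PP : ProjPlane q) (S : Set PP.Point)
    (hS : S.ncard = i) (hi : 2 ≤ i)
    (hskew : ∃ l : PP.Line, ∀ P ∈ S, ¬ PP.incid P l) :
    ∃ P : PP.Point, P ∉ S ∧
      ((PP.uncov (S ∪ {P})).ncard : ℝ) ≤
        ((PP.uncov S).ncard : ℝ) * (1 - (i : ℝ) * ((q : ℝ) - 1) / ((q : ℝ) * ((q : ℝ) + 1))) := by
  classical
  have := PP.finite_point
  have := Fintype.ofFinite PP.Point
  obtain ⟨l, hl⟩ := hskew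
  obtain ⟨A, hA⟩ : S.Nonempty := Set.nonempty_of_ncard_ne_zero (by omega)
  have hcompl : Sᶜ.ncard ≤ q * (q + 1) :=
    (Set.ncard_le_ncard (Set.compl_subset_compl.mpr (Set.singleton_subset_iff.mpr hA))).trans
      (ProjPlane.ncard_compl_singleton_le (hl A hA))
  obtain ⟨Y, hY⟩ : (PP.pts l).Nonempty :=
    Set.nonempty_of_ncard_ne_zero (by rw [PP.ncard_pts]; omega)
  have hYS : Y ∈ Sᶜ := fun h => hl Y h hY
  have hq : 1 ≤ q := by
    have := (Set.ncard_pos (s := Sᶜ)).mpr ⟨Y, hYS⟩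
    by_contra h
    simp_all
  let D := Sᶜ.toFinset
  let R := (PP.uncov S).toFinset
  let removed : PP.Point → Finset PP.Point := fun P => {Q ∈ R | Q ∉ PP.uncov (S ∪ {P})}
  have hremoved : ∀ P, (PP.uncov (S ∪ {P})).ncard + (removed P).card = (PP.uncov S).ncard := by
    intro P
    have hfilter : {Q ∈ R | Q ∈ PP.uncov (S ∪ {P})} = (PP.uncov (S ∪ {P})).toFinset := by
      ext Q
      simpa [R] using fun h => ProjPlane.uncov_anti (Set.subset_insert P S) h
    rw [Set.ncard_eq_toFinset_card', Set.ncard_eq_toFinset_card', ← hfilter]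
    exact Finset.card_filter_add_card_filter_not _
  have hsum : (PP.uncov S).ncard * (i * (q - 1)) ≤ ∑ P ∈ D, (removed P).card := by
    have := Finset.sum_card_bipartiteAbove_eq_sum_card_bipartiteBelow (s := D) (t := R)
      fun P Q => Q ∉ PP.uncov (S ∪ {P})
    refine le_of_le_of_eq ?_ this.symm
    rw [Set.ncard_eq_toFinset_card', ← smul_eq_mul]
    refine Finset.card_nsmul_le_sum _ _ _ fun Q hQ => ?_
    rw [← hS]
    refine (ProjPlane.mul_le_ncard_covering (Set.mem_toFinset.mp hQ)).trans_eq ?_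
    rw [Set.ncard_eq_toFinset_card']
    congr 1
    ext P
    simp [D, Finset.bipartiteBelow]
  have hDcard : D.card ≤ q * (q + 1) := by rwa [← Set.ncard_eq_toFinset_card']
  obtain ⟨P, hPD, hP⟩ : ∃ P ∈ D,
      (PP.uncov S).ncard * (i * (q - 1)) ≤ (removed P).card * (q * (q + 1)) := by
    by_contra! h
    have hlt := Finset.sum_lt_sum_of_nonempty ⟨Y, Set.mem_toFinset.mpr hYS⟩ h
    rw [← Finset.sum_mul, Finset.sum_const, smul_eq_mul] at hlt
    have hle := Nat.mul_le_mul_right (q * (q + 1)) hsum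
    have hle' := Nat.mul_le_mul_right ((PP.uncov S).ncard * (i * (q - 1))) hDcard
    linarith
  refine ⟨P, Set.mem_toFinset.mp hPD, ?_⟩
  have hPr : ((PP.uncov S).ncard : ℝ) * (i * ((q : ℝ) - 1)) ≤
      (removed P).card * ((q : ℝ) * (q + 1)) := by
    have := (Nat.cast_le (α := ℝ)).mpr hP
    push_cast [Nat.cast_sub hq] at this
    exact this
  have hadd : ((PP.uncov (S ∪ {P})).ncard : ℝ) + (removed P).card = (PP.uncov S).ncard := by
    exact_mod_cast hremoved P
  have hpos : (0 : ℝ) < (q : ℝ) * (q + 1) := by positivity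
  rw [mul_sub, mul_one, ← mul_div_assoc]
  linarith [(div_le_iff₀ hpos).mpr hPr]
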